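/- Let c ∈ ℝ and R > 0 be such that every eigenvalue of A and every eigenvalue of T lies in the open disk { z : |z − c| < R }, let f : ℂ → ℂ be complex differentiable on an open set containing the closed disk { z : |z − c| ≤ R }, and let w ∈ ℝ be such that w is not an eigenvalue of A or of T. Let S₀, S₁, …, S_k be nonempty compact subsets of ℝ, each disjoint from the circle { z : |z − c| = R }, such that every eigenvalue of A lies in S₀ and the i-th eigenvalue λ_i(T) of T lies in S_i for i = 1, …, k. Then | bᴴ f(A) b − bᴴ Q f(T) Qᴴ b | ≤ ( (1/(2π)) ∫₀^{2π} |f(c + Re^{iθ})| · ( ∏_{i=1}^{k} sup_{x ∈ S_i} |(x − w)/(x − (c + Re^{iθ}))|² ) · ( sup_{x ∈ S₀} |1/(x − (c + Re^{iθ}))| ) · R dθ ) · ‖res_k(w)‖₂². -/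

import Mathlib

open Matrix MeasureTheory

/-- The Euclidean 2-norm of a complex vector. -/
noncomputable def norm2 {n : ℕ} (v : Fin n → ℂ) : ℝ :=
  Real.sqrt (∑ i, ‖v i‖ ^ 2)

/-- Apply a scalar function to a Hermitian matrix through its spectral decomposition. -/
noncomputable def matFun {m : ℕ} {B : Matrix (Fin m) (Fin m) ℂ}
    (hB : B.IsHermitian) (f : ℝ → ℂ) : Matrix (Fin m) (Fin m) ℂ :=
  (hB.eigenvectorUnitary : Matrix (Fin m) (Fin m) ℂ) *
    Matrix.diagonal (fun i => f (hB.eigenvalues i)) *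
    star (hB.eigenvectorUnitary : Matrix (Fin m) (Fin m) ℂ)

/-- The Lanczos-FA error for the shifted linear system `(A - z I) x = b`. -/
noncomputable def errK {n k : ℕ} (A : Matrix (Fin n) (Fin n) ℂ) (Q : Matrix (Fin n) (Fin k) ℂ)
    (T : Matrix (Fin k) (Fin k) ℂ) (b : Fin n → ℂ) (z : ℂ) : Fin n → ℂ :=
  (A - z • 1)⁻¹.mulVec b - (Q * (T - z • 1)⁻¹ * Qᴴ).mulVec b

/-- The Lanczos-FA residual for the shifted linear system `(A - z I) x = b`. -/
noncomputable def resK {n k : ℕ} (A : Matrix (Fin n) (Fin n) ℂ) (Q : Matrix (Fin n) (Fin k) ℂ)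
    (T : Matrix (Fin k) (Fin k) ℂ) (b : Fin n → ℂ) (z : ℂ) : Fin n → ℂ :=
  b - ((A - z • 1) * (Q * (T - z • 1)⁻¹ * Qᴴ)).mulVec b

lemma norm2_nonneg {n : ℕ} (v : Fin n → ℂ) : 0 ≤ norm2 v := Real.sqrt_nonneg _

lemma norm2_sq {n : ℕ} (v : Fin n → ℂ) : norm2 v ^ 2 = ∑ i, ‖v i‖ ^ 2 :=
  Real.sq_sqrt (Finset.sum_nonneg fun _ _ => sq_nonneg _)

lemma norm2_smul {n : ℕ} (a : ℂ) (v : Fin n → ℂ) : norm2 (a • v) = ‖a‖ * norm2 v := by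
  rw [← sq_eq_sq₀ (norm2_nonneg _) (mul_nonneg (norm_nonneg _) (norm2_nonneg _)),
    mul_pow, norm2_sq, norm2_sq, Finset.mul_sum]
  simp [mul_pow]

lemma norm2_pos {n : ℕ} {v : Fin n → ℂ} (hv : v ≠ 0) : 0 < norm2 v := by
  obtain ⟨i, hi⟩ := Function.ne_iff.mp hv
  refine Real.sqrt_pos.mpr (Finset.sum_pos' (fun _ _ => sq_nonneg _) ⟨i, Finset.mem_univ i, ?_⟩)
  exact pow_pos (norm_pos_iff.mpr hi) 2

lemma star_dotProduct_self_eq_norm2_sq {n : ℕ} (v : Fin n → ℂ) :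
    star v ⬝ᵥ v = ((norm2 v ^ 2 : ℝ) : ℂ) := by
  rw [norm2_sq]
  simp [dotProduct, Complex.conj_mul']

section HermitianCalculus

variable {m : ℕ} {B : Matrix (Fin m) (Fin m) ℂ}

/-- The quadratic form of `matFun` is a spectral sum. -/
lemma star_dotProduct_matFun_mulVec (hB : B.IsHermitian) (f : ℝ → ℂ) (v : Fin m → ℂ) :
    star v ⬝ᵥ (matFun hB f).mulVec v =
      ∑ i, f (hB.eigenvalues i) *
        ((‖((hB.eigenvectorUnitary : Matrix (Fin m) (Fin m) ℂ)ᴴ.mulVec v) i‖ ^ 2 : ℝ) : ℂ) := by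
  have h : star v ᵥ* (hB.eigenvectorUnitary : Matrix (Fin m) (Fin m) ℂ) =
      star ((hB.eigenvectorUnitary : Matrix (Fin m) (Fin m) ℂ)ᴴ.mulVec v) := by
    rw [star_mulVec, conjTranspose_conjTranspose]
  rw [matFun, star_eq_conjTranspose, ← mulVec_mulVec, ← mulVec_mulVec, dotProduct_mulVec, h]
  simp only [dotProduct, mulVec_diagonal, Pi.star_apply]
  refine Finset.sum_congr rfl fun i _ => ?_
  rw [mul_left_comm]
  congr 1
  push_cast
  exact Complex.conj_mul' _

/-- A unitary change of basis preserves the Euclidean norm. -/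
lemma sum_norm_sq_eigenvectorUnitary_mulVec (hB : B.IsHermitian) (v : Fin m → ℂ) :
    ∑ i, ‖((hB.eigenvectorUnitary : Matrix (Fin m) (Fin m) ℂ)ᴴ.mulVec v) i‖ ^ 2 =
      norm2 v ^ 2 := by
  rw [← norm2_sq, ← Complex.ofReal_inj, ← star_dotProduct_self_eq_norm2_sq,
    ← star_dotProduct_self_eq_norm2_sq, star_mulVec, conjTranspose_conjTranspose,
    ← dotProduct_mulVec, mulVec_mulVec, ← star_eq_conjTranspose,
    Unitary.mul_star_self_of_mem hB.eigenvectorUnitary.2,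
    one_mulVec]

lemma norm_star_dotProduct_matFun_mulVec_le (hB : B.IsHermitian) (f : ℝ → ℂ) (v : Fin m → ℂ)
    {C : ℝ} (hC : ∀ i, ‖f (hB.eigenvalues i)‖ ≤ C) :
    ‖star v ⬝ᵥ (matFun hB f).mulVec v‖ ≤ C * norm2 v ^ 2 := by
  rw [star_dotProduct_matFun_mulVec, ← sum_norm_sq_eigenvectorUnitary_mulVec hB v, Finset.mul_sum]
  refine (norm_sum_le _ _).trans (Finset.sum_le_sum fun i _ => ?_)
  rw [norm_mul, Complex.norm_real, Real.norm_of_nonneg (sq_nonneg _)]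
  exact mul_le_mul_of_nonneg_right (hC i) (sq_nonneg _)

lemma sub_smul_one_eq (hB : B.IsHermitian) (z : ℂ) :
    B - z • 1 = (hB.eigenvectorUnitary : Matrix (Fin m) (Fin m) ℂ) *
      diagonal (fun i => (hB.eigenvalues i : ℂ) - z) *
      star (hB.eigenvectorUnitary : Matrix (Fin m) (Fin m) ℂ) := by
  have h1 : diagonal (fun i => (hB.eigenvalues i : ℂ) - z) =
      diagonal (RCLike.ofReal ∘ hB.eigenvalues) - z • (1 : Matrix (Fin m) (Fin m) ℂ) := by
    rw [smul_one_eq_diagonal, diagonal_sub]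
    rfl
  have h2 := hB.spectral_theorem
  rw [Unitary.conjStarAlgAut_apply] at h2
  rw [h1, mul_sub, sub_mul, ← h2, mul_smul_comm, smul_mul_assoc, mul_one,
    Unitary.mul_star_self_of_mem hB.eigenvectorUnitary.2]

lemma det_sub_smul_one (hB : B.IsHermitian) (z : ℂ) :
    (B - z • 1).det = ∏ i, ((hB.eigenvalues i : ℂ) - z) := by
  rw [sub_smul_one_eq hB, det_mul_comm, ← mul_assoc, Unitary.coe_star_mul_self, one_mul,
    det_diagonal]

lemma isUnit_det_sub_smul_one (hB : B.IsHermitian) {z : ℂ}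
    (hz : ∀ i, (hB.eigenvalues i : ℂ) ≠ z) : IsUnit (B - z • 1).det := by
  rw [det_sub_smul_one hB, isUnit_iff_ne_zero, Finset.prod_ne_zero_iff]
  exact fun i _ => sub_ne_zero.mpr (hz i)

lemma matFun_resolvent (hB : B.IsHermitian) {z : ℂ} (hz : ∀ i, (hB.eigenvalues i : ℂ) ≠ z) :
    matFun hB (fun x : ℝ => ((x : ℂ) - z)⁻¹) = (B - z • 1)⁻¹ := by
  refine (inv_eq_right_inv ?_).symm
  rw [sub_smul_one_eq hB, matFun, mul_assoc, ← mul_assoc (star _) _ (star _),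
    ← mul_assoc (star _) _ (diagonal _), Unitary.coe_star_mul_self, one_mul, mul_assoc,
    ← mul_assoc (diagonal _), diagonal_mul_diagonal]
  have : (fun i => ((hB.eigenvalues i : ℂ) - z) * ((hB.eigenvalues i : ℂ) - z)⁻¹) =
      fun _ => 1 := funext fun i => mul_inv_cancel₀ (sub_ne_zero.mpr (hz i))
  rw [this, diagonal_one, one_mul, Unitary.mul_star_self_of_mem hB.eigenvectorUnitary.2]

/-- Cauchy's integral formula for the quadratic form of a function of a Hermitian matrix. -/
lemma circleIntegral_resolvent_quadratic_form (hB : B.IsHermitian) {c : ℂ} {R : ℝ} (hR : 0 < R)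
    (hspec : ∀ i, (hB.eigenvalues i : ℂ) ∈ Metric.ball c R) {f : ℂ → ℂ}
    (hf : DifferentiableOn ℂ f (Metric.closedBall c R)) (v : Fin m → ℂ) :
    CircleIntegrable
        (fun z => f z * (star v ⬝ᵥ (matFun hB fun x : ℝ => ((x : ℂ) - z)⁻¹).mulVec v)) c R ∧
      (∮ z in C(c, R), f z * (star v ⬝ᵥ (matFun hB fun x : ℝ => ((x : ℂ) - z)⁻¹).mulVec v)) =
        -((2 * Real.pi * Complex.I) *
          (star v ⬝ᵥ (matFun hB fun x : ℝ => f (x : ℂ)).mulVec v)) := by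
  set y := fun i =>
    ((‖((hB.eigenvectorUnitary : Matrix (Fin m) (Fin m) ℂ)ᴴ.mulVec v) i‖ ^ 2 : ℝ) : ℂ)
  have hsum : (fun z => f z * (star v ⬝ᵥ (matFun hB fun x : ℝ => ((x : ℂ) - z)⁻¹).mulVec v)) =
      fun z => ∑ i, -y i * ((z - (hB.eigenvalues i : ℂ))⁻¹ • f z) := by
    funext z
    rw [star_dotProduct_matFun_mulVec, Finset.mul_sum]
    refine Finset.sum_congr rfl fun i _ => ?_
    rw [← neg_sub z, inv_neg, smul_eq_mul]
    ring
  have hint : ∀ i ∈ Finset.univ, CircleIntegrable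
      (fun z => -y i * ((z - (hB.eigenvalues i : ℂ))⁻¹ • f z)) c R := by
    intro i _
    refine ContinuousOn.circleIntegrable hR.le (continuousOn_const.mul (ContinuousOn.smul
      (ContinuousOn.inv₀ (continuousOn_id.sub continuousOn_const) fun z hz h => ?_)
      (hf.continuousOn.mono Metric.sphere_subset_closedBall)))
    replace h : z = hB.eigenvalues i := sub_eq_zero.mp h
    have h1 := hspec i
    rw [← h, Metric.mem_ball] at h1
    exact h1.ne hz
  rw [hsum]
  refine ⟨CircleIntegrable.fun_sum _ hint, ?_⟩
  rw [circleIntegral.integral_fun_sum hint, star_dotProduct_matFun_mulVec, Finset.mul_sum,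
    ← Finset.sum_neg_distrib]
  refine Finset.sum_congr rfl fun i _ => ?_
  rw [circleIntegral.integral_const_mul, hf.circleIntegral_sub_inv_smul (hspec i), smul_eq_mul]
  ring

end HermitianCalculus

/-- The corner cofactor of a shifted tridiagonal matrix does not depend on the shift. -/
lemma adjugate_sub_smul_one_last_zero {m : ℕ} (M : Matrix (Fin (m + 1)) (Fin (m + 1)) ℂ)
    (hM : ∀ i j : Fin (m + 1), (j : ℕ) + 1 < (i : ℕ) → M i j = 0) (z w : ℂ) :
    (M - z • 1).adjugate (Fin.last m) 0 = (M - w • 1).adjugate (Fin.last m) 0 := by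
  have key : ∀ z : ℂ, ((M - z • 1).submatrix (0 : Fin (m + 1)).succAbove
      (Fin.last m).succAbove).det = ∏ i : Fin m, M i.succ i.castSucc := by
    intro z
    rw [det_of_isUpperTriangular]
    · refine Finset.prod_congr rfl fun i _ => ?_
      have : i.succ ≠ i.castSucc := by simp [Fin.ext_iff]
      simp [one_apply_ne this]
    · intro i j hij
      have hij' : (j : ℕ) < (i : ℕ) := hij
      have hne : i.succ ≠ j.castSucc := by
        simp only [ne_eq, Fin.ext_iff, Fin.val_succ, Fin.val_castSucc]
        omega
      have h0 : M i.succ j.castSucc = 0 := hM _ _ (by simpa using hij')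
      simp [one_apply_ne hne, h0]
  rw [adjugate_fin_succ_eq_det_submatrix, adjugate_fin_succ_eq_det_submatrix, key, key]

/-- The corner entry of the resolvent of a tridiagonal matrix is proportional to the inverse of
the characteristic determinant. -/
lemma det_mul_inv_sub_smul_one_corner {k : ℕ} (hk : 0 < k) (M : Matrix (Fin k) (Fin k) ℂ)
    (hM : ∀ i j : Fin k, (j : ℕ) + 1 < (i : ℕ) → M i j = 0) {z w : ℂ}
    (hz : IsUnit (M - z • 1).det) (hw : IsUnit (M - w • 1).det) :
    (M - z • 1).det * (M - z • 1)⁻¹ ⟨k - 1, Nat.sub_lt hk Nat.one_pos⟩ ⟨0, hk⟩ =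
      (M - w • 1).det * (M - w • 1)⁻¹ ⟨k - 1, Nat.sub_lt hk Nat.one_pos⟩ ⟨0, hk⟩ := by
  obtain ⟨m, rfl⟩ : ∃ m, k = m + 1 := ⟨k - 1, by omega⟩
  have key : ∀ z : ℂ, IsUnit (M - z • 1).det → (M - z • 1).det * (M - z • 1)⁻¹ (Fin.last m) 0 =
      (M - z • 1).adjugate (Fin.last m) 0 := by
    intro z hz
    rw [inv_def, Matrix.smul_apply, smul_eq_mul, ← mul_assoc, Ring.mul_inverse_cancel _ hz, one_mul]
  exact (key z hz).trans ((adjugate_sub_smul_one_last_zero M hM z w).trans (key w hw).symm)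

/-- The supremum over a compact set of parameters is continuous, given continuity only on the
parameters in that set. -/
lemma IsCompact.continuous_sSup_image_of_subtype {K : Set ℝ} (hK : IsCompact K) {g : ℝ → ℝ → ℝ}
    (hg : Continuous fun p : ℝ × K => g p.1 p.2) :
    Continuous fun θ => sSup (g θ '' K) := by
  have := isCompact_iff_compactSpace.mp hK
  have h := (isCompact_univ (X := K)).continuous_sSup (f := fun θ (x : K) => g θ x) hg
  convert h using 2 with θ
  congr 1
  ext y
  simp

section Lanczos

variable {n k : ℕ} {A : Matrix (Fin n) (Fin n) ℂ} {b q : Fin n → ℂ} {Q : Matrix (Fin n) (Fin k) ℂ}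
  {T : Matrix (Fin k) (Fin k) ℂ} {β s : ℝ} {i l : Fin k}

lemma sub_smul_one_mul_of_lanczos
    (hAQ : A * Q = Q * T + (β : ℂ) • vecMulVec q (Pi.single l 1)) (z : ℂ) :
    (A - z • 1) * Q = Q * (T - z • 1) + (β : ℂ) • vecMulVec q (Pi.single l 1) := by
  rw [Matrix.sub_mul, hAQ, Matrix.mul_sub, Matrix.smul_mul, Matrix.one_mul, Matrix.mul_smul,
    Matrix.mul_one]
  abel

/-- The Lanczos residual is a multiple of the next Lanczos vector. -/
lemma resK_eq_smul (hQ : Qᴴ * Q = 1) (hb : b = (s : ℂ) • Q.mulVec (Pi.single i 1))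
    (hAQ : A * Q = Q * T + (β : ℂ) • vecMulVec q (Pi.single l 1)) {z : ℂ}
    (hz : IsUnit (T - z • 1).det) :
    resK A Q T b z = (-((β : ℂ) * s * (T - z • 1)⁻¹ l i)) • q := by
  have hQb : Qᴴ.mulVec b = (s : ℂ) • Pi.single i 1 := by
    rw [hb, mulVec_smul, mulVec_mulVec, hQ, one_mulVec]
  rw [resK, ← Matrix.mul_assoc, ← Matrix.mul_assoc, sub_smul_one_mul_of_lanczos hAQ,
    ← mulVec_mulVec, hQb, Matrix.add_mul, Matrix.mul_assoc Q, mul_nonsing_inv _ hz, Matrix.mul_one, mulVec_smul,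
    add_mulVec, smul_add, ← hb, sub_add_cancel_left, ← mulVec_mulVec, smul_mulVec,
    vecMulVec_mulVec, mulVec_single_one, single_one_dotProduct]
  ext j
  simp [col]
  ring

/-- The resolvent error in the quadratic form is a multiple of `qᴴ (A - z)⁻¹ q`. -/
lemma resolvent_quadratic_form_error (hA : A.IsHermitian) (hT : T.IsHermitian)
    (hQ : Qᴴ * Q = 1) (hb : b = (s : ℂ) • Q.mulVec (Pi.single i 1)) (hQq : Qᴴ.mulVec q = 0)
    (hAQ : A * Q = Q * T + (β : ℂ) • vecMulVec q (Pi.single l 1)) {z : ℂ}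
    (hzA : IsUnit (A - z • 1).det) (hz : IsUnit (T - z • 1).det) :
    star b ⬝ᵥ (A - z • 1)⁻¹.mulVec b - star (Qᴴ.mulVec b) ⬝ᵥ (T - z • 1)⁻¹.mulVec (Qᴴ.mulVec b) =
      ((β : ℂ) * s) ^ 2 * ((T - z • 1)⁻¹ l i * (T - z • 1)⁻¹ i l) *
        (star q ⬝ᵥ (A - z • 1)⁻¹.mulVec q) := by
  have herr : (A - z • 1)⁻¹.mulVec b - (Q * (T - z • 1)⁻¹ * Qᴴ).mulVec b =
      (A - z • 1)⁻¹.mulVec (resK A Q T b z) := by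
    rw [resK, mulVec_sub, mulVec_mulVec, ← Matrix.mul_assoc, nonsing_inv_mul _ hzA,
      Matrix.one_mul]
  have hAQ' : Qᴴ * (A - z • 1) =
      (T - z • 1) * Qᴴ + (β : ℂ) • vecMulVec (Pi.single l 1) (star q) := by
    have h := congrArg conjTranspose (sub_smul_one_mul_of_lanczos hAQ (star z))
    simpa [conjTranspose_sub, hA.eq, hT.eq, conjTranspose_smul, conjTranspose_vecMulVec,
      Pi.single_star] using h
  have hG : Qᴴ.mulVec ((A - z • 1)⁻¹.mulVec q) =
      (-((β : ℂ) * (star q ⬝ᵥ (A - z • 1)⁻¹.mulVec q))) • (T - z • 1)⁻¹.mulVec (Pi.single l 1) := by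
    have h : Qᴴ.mulVec q = (T - z • 1).mulVec (Qᴴ.mulVec ((A - z • 1)⁻¹.mulVec q)) +
        ((β : ℂ) * (star q ⬝ᵥ (A - z • 1)⁻¹.mulVec q)) • (Pi.single l 1 : Fin k → ℂ) := by
      have h1 := congrArg (fun M => M.mulVec ((A - z • 1)⁻¹.mulVec q)) hAQ'
      rw [mulVec_mulVec, Matrix.mul_assoc, mul_nonsing_inv _ hzA, Matrix.mul_one, add_mulVec,
        ← mulVec_mulVec, smul_mulVec, vecMulVec_mulVec] at h1
      rw [h1]
      ext j
      simp
      ring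
    rw [hQq] at h
    have h2 := congrArg (fun v => (T - z • 1)⁻¹.mulVec v) h
    rw [mulVec_zero, mulVec_add, mulVec_mulVec, nonsing_inv_mul _ hz, one_mulVec, mulVec_smul] at h2
    rw [neg_smul]
    exact eq_neg_of_add_eq_zero_left h2.symm
  have hform : star (Qᴴ.mulVec b) ⬝ᵥ (T - z • 1)⁻¹.mulVec (Qᴴ.mulVec b) =
      star b ⬝ᵥ (Q * (T - z • 1)⁻¹ * Qᴴ).mulVec b := by
    rw [star_mulVec, conjTranspose_conjTranspose, ← dotProduct_mulVec, mulVec_mulVec,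
      mulVec_mulVec]
  have hbG : star b ⬝ᵥ (A - z • 1)⁻¹.mulVec q =
      -((β : ℂ) * s * (T - z • 1)⁻¹ i l * (star q ⬝ᵥ (A - z • 1)⁻¹.mulVec q)) := by
    have h : star b = (s : ℂ) • (Pi.single i 1 ᵥ* Qᴴ) := by
      rw [hb, star_smul, star_mulVec, ← Pi.single_star, star_one]
      simp
    rw [h, smul_dotProduct, ← dotProduct_mulVec, hG, dotProduct_smul, mulVec_single_one,
      single_one_dotProduct]
    simp [col]
    ring
  rw [hform, ← dotProduct_sub, herr, resK_eq_smul hQ hb hAQ hz, mulVec_smul, dotProduct_smul, hbG,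
    smul_eq_mul]
  ring

/-- Pointwise bound for the resolvent error in the quadratic form by the residual at `w`. -/
lemma norm_resolvent_quadratic_form_error_le (hk : 0 < k) (hA : A.IsHermitian)
    (hT : T.IsHermitian) (hTsymm : T.IsSymm)
    (hTtri : ∀ i j : Fin k, (j : ℕ) + 1 < (i : ℕ) → T i j = 0)
    (hQ : Qᴴ * Q = 1) (hb : b = (s : ℂ) • Q.mulVec (Pi.single ⟨0, hk⟩ 1))
    (hq : norm2 q = 1) (hQq : Qᴴ.mulVec q = 0)
    (hAQ : A * Q = Q * T + (β : ℂ) •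
      vecMulVec q (Pi.single ⟨k - 1, Nat.sub_lt hk Nat.one_pos⟩ 1)) {z w : ℂ}
    (hzA : ∀ i, (hA.eigenvalues i : ℂ) ≠ z) (hzT : ∀ i, (hT.eigenvalues i : ℂ) ≠ z)
    (hwT : ∀ i, (hT.eigenvalues i : ℂ) ≠ w) {C : ℝ}
    (hC : ∀ i, ‖1 / ((hA.eigenvalues i : ℂ) - z)‖ ≤ C) :
    ‖star b ⬝ᵥ (matFun hA fun x : ℝ => ((x : ℂ) - z)⁻¹).mulVec b -
        star (Qᴴ.mulVec b) ⬝ᵥ (matFun hT fun x : ℝ => ((x : ℂ) - z)⁻¹).mulVec (Qᴴ.mulVec b)‖ ≤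
      (∏ i, ‖((hT.eigenvalues i : ℂ) - w) / ((hT.eigenvalues i : ℂ) - z)‖ ^ 2) * C *
        norm2 (resK A Q T b w) ^ 2 := by
  have huz := isUnit_det_sub_smul_one hT hzT
  have huw := isUnit_det_sub_smul_one hT hwT
  have hGq : ‖star q ⬝ᵥ (A - z • 1)⁻¹.mulVec q‖ ≤ C := by
    rw [← matFun_resolvent hA hzA]
    simpa [hq] using norm_star_dotProduct_matFun_mulVec_le hA (fun x : ℝ => ((x : ℂ) - z)⁻¹) q
      (fun i => by simpa using hC i)
  have hsymm : ((T - z • 1)⁻¹).IsSymm := by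
    rw [IsSymm, transpose_nonsing_inv, transpose_sub, transpose_smul, transpose_one, hTsymm.eq]
  have hcorner := det_mul_inv_sub_smul_one_corner hk T hTtri huz huw
  rw [matFun_resolvent hA hzA, matFun_resolvent hT hzT,
    resolvent_quadratic_form_error hA hT hQ hb hQq hAQ (isUnit_det_sub_smul_one hA hzA) huz,
    resK_eq_smul hQ hb hAQ huw, norm2_smul, hq,
    hsymm.apply ⟨k - 1, Nat.sub_lt hk Nat.one_pos⟩ ⟨0, hk⟩, Finset.prod_pow, ← norm_prod,
    Finset.prod_div_distrib, ← det_sub_smul_one, ← det_sub_smul_one]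
  have hH : (T - z • 1)⁻¹ ⟨k - 1, Nat.sub_lt hk Nat.one_pos⟩ ⟨0, hk⟩ =
      (T - w • 1).det / (T - z • 1).det *
        (T - w • 1)⁻¹ ⟨k - 1, Nat.sub_lt hk Nat.one_pos⟩ ⟨0, hk⟩ := by
    rw [div_mul_eq_mul_div, ← hcorner, mul_div_cancel_left₀ _ huz.ne_zero]
  rw [hH]
  simp only [norm_mul, norm_neg, norm_pow]
  refine (mul_le_mul_of_nonneg_left hGq (by positivity)).trans_eq ?_
  ring

end Lanczos

theorem lanczos_quadratic_form_integral_bound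
    {n k : ℕ} (hn : 0 < n) (hk : 0 < k)
    (A : Matrix (Fin n) (Fin n) ℂ) (hA : A.IsHermitian)
    (b : Fin n → ℂ) (hb : b ≠ 0)
    (Q : Matrix (Fin n) (Fin k) ℂ) (hQ : Qᴴ * Q = 1)
    (hQb : Q.mulVec (Pi.single (⟨0, hk⟩ : Fin k) 1) = (norm2 b)⁻¹ • b)
    (T : Matrix (Fin k) (Fin k) ℝ) (hTsymm : T.IsSymm)
    (hTtri : ∀ i j : Fin k, (i : ℕ) + 1 < (j : ℕ) ∨ (j : ℕ) + 1 < (i : ℕ) → T i j = 0)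
    (hToff : ∀ i j : Fin k, (i : ℕ) + 1 = (j : ℕ) → 0 < T i j)
    (βk : ℝ) (hβk : 0 < βk)
    (q : Fin n → ℂ) (hq : norm2 q = 1) (hQq : Qᴴ.mulVec q = 0)
    (hAQ : A * Q = Q * T.map Complex.ofReal + (βk : ℂ) •
      Matrix.vecMulVec q (Pi.single (⟨k - 1, Nat.sub_lt hk Nat.one_pos⟩ : Fin k) 1))
    (hTH : (T.map Complex.ofReal).IsHermitian)
    (c R : ℝ) (hR : 0 < R)
    (hspecA : ∀ i, |hA.eigenvalues i - c| < R)
    (hspecT : ∀ i, |hTH.eigenvalues i - c| < R)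
    (f : ℂ → ℂ)
    (hf : ∃ U : Set ℂ, IsOpen U ∧ Metric.closedBall (c : ℂ) R ⊆ U ∧ DifferentiableOn ℂ f U)
    (w : ℝ) (hwA : ∀ i, hA.eigenvalues i ≠ w) (hwT : ∀ i, hTH.eigenvalues i ≠ w)
    (S : Fin (k + 1) → Set ℝ)
    (hSne : ∀ i, (S i).Nonempty) (hScpt : ∀ i, IsCompact (S i))
    (hScirc : ∀ i, ∀ x ∈ S i, |x - c| ≠ R)
    (hSA : ∀ i, hA.eigenvalues i ∈ S 0)
    (hST : ∀ i : Fin k, hTH.eigenvalues i ∈ S i.succ) :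
    ‖star b ⬝ᵥ (matFun hA fun x : ℝ => f (x : ℂ)).mulVec b -
        star b ⬝ᵥ (Q * matFun hTH (fun x : ℝ => f (x : ℂ)) * Qᴴ).mulVec b‖ ≤
      ((2 * Real.pi)⁻¹ *
          ∫ θ in (0 : ℝ)..(2 * Real.pi),
            ‖f ((c : ℂ) + R * Complex.exp (θ * Complex.I))‖ *
              (∏ i : Fin k,
                sSup ((fun x : ℝ =>
                  ‖((x : ℂ) - (w : ℂ)) / ((x : ℂ) - ((c : ℂ) + R * Complex.exp (θ * Complex.I)))‖ ^ 2)
                  '' S i.succ)) *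
              sSup ((fun x : ℝ =>
                ‖1 / ((x : ℂ) - ((c : ℂ) + R * Complex.exp (θ * Complex.I)))‖)
                '' S 0) * R) *
        norm2 (resK A Q (T.map Complex.ofReal) b (w : ℂ)) ^ 2 := by
  obtain ⟨U, -, hUsub, hUf⟩ := hf
  have hfd : DifferentiableOn ℂ f (Metric.closedBall (c : ℂ) R) := hUf.mono hUsub
  have hball : ∀ x : ℝ, |x - c| < R → (x : ℂ) ∈ Metric.ball (c : ℂ) R := fun x hx => by
    rwa [Metric.mem_ball, dist_eq_norm, ← Complex.ofReal_sub, Complex.norm_real]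
  have hcirc : ∀ (x θ : ℝ), |x - c| ≠ R → (x : ℂ) ≠ circleMap c R θ := fun x θ hx h => by
    have h1 := circleMap_mem_sphere (c : ℂ) hR.le θ
    rw [← h, Metric.mem_sphere, dist_eq_norm, ← Complex.ofReal_sub, Complex.norm_real] at h1
    exact hx h1
  have hden : ∀ i (p : ℝ × S i), ((p.2 : ℝ) : ℂ) - circleMap c R p.1 ≠ 0 := fun i p =>
    sub_ne_zero.mpr (hcirc _ _ (hScirc i _ p.2.2))
  have hbs : b = (norm2 b : ℂ) • Q.mulVec (Pi.single (⟨0, hk⟩ : Fin k) 1) := by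
    rw [hQb, ← Complex.coe_smul, smul_smul, Complex.ofReal_inv,
      mul_inv_cancel₀ (Complex.ofReal_ne_zero.mpr (norm2_pos hb).ne'), one_smul]
  set F : ℝ → ℝ → ℝ := fun θ x => ‖1 / ((x : ℂ) - circleMap c R θ)‖
  set G : ℝ → ℝ → ℝ := fun θ x => ‖((x : ℂ) - (w : ℂ)) / ((x : ℂ) - circleMap c R θ)‖ ^ 2
  have hFc : ∀ i, Continuous fun p : ℝ × S i => F p.1 p.2 := fun i =>
    (Continuous.div continuous_const (by fun_prop) (hden i)).norm
  have hGc : ∀ i, Continuous fun p : ℝ × S i => G p.1 p.2 := fun i =>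
    (Continuous.div (by fun_prop) (by fun_prop) (hden i)).norm.pow 2
  have hle : ∀ i (g : ℝ → ℝ → ℝ), (Continuous fun p : ℝ × S i => g p.1 p.2) →
      ∀ θ, ∀ x ∈ S i, g θ x ≤ sSup (g θ '' S i) := fun i g hg θ x hx => by
    refine le_csSup ((hScpt i).image_of_continuousOn ?_).bddAbove (Set.mem_image_of_mem _ hx)
    exact continuousOn_iff_continuous_domRestrict.mpr (hg.comp (Continuous.prodMk_right θ))
  set r := norm2 (resK A Q (T.map Complex.ofReal) b (w : ℂ))
  set bound : ℝ → ℝ := fun θ => ‖f (circleMap c R θ)‖ *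
    (∏ i : Fin k, sSup (G θ '' S i.succ)) * sSup (F θ '' S 0) * R with hbound
  have hboundc : Continuous bound := by
    have hfc : Continuous fun θ => f (circleMap c R θ) :=
      hfd.continuousOn.comp_continuous (continuous_circleMap _ _)
        fun θ => circleMap_mem_closedBall _ hR.le _
    exact ((hfc.norm.mul (continuous_finsetProd _ fun i _ =>
      (hScpt i.succ).continuous_sSup_image_of_subtype (hGc i.succ))).mul
        ((hScpt 0).continuous_sSup_image_of_subtype (hFc 0))).mul continuous_const
  obtain ⟨hiA, heA⟩ := circleIntegral_resolvent_quadratic_form hA hR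
    (fun i => hball _ (hspecA i)) hfd b
  obtain ⟨hiT, heT⟩ := circleIntegral_resolvent_quadratic_form hTH hR
    (fun i => hball _ (hspecT i)) hfd (Qᴴ.mulVec b)
  have hcauchy := circleIntegral.integral_sub hiA hiT
  rw [heA, heT] at hcauchy
  have hnorm : ‖∮ z in C((c : ℂ), R),
      (f z * (star b ⬝ᵥ (matFun hA fun x : ℝ => ((x : ℂ) - z)⁻¹).mulVec b) -
        f z * (star (Qᴴ.mulVec b) ⬝ᵥ
          (matFun hTH fun x : ℝ => ((x : ℂ) - z)⁻¹).mulVec (Qᴴ.mulVec b)))‖ ≤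
      ∫ θ in (0 : ℝ)..(2 * Real.pi), bound θ * r ^ 2 := by
    refine intervalIntegral.norm_integral_le_of_norm_le (by positivity)
      (Filter.Eventually.of_forall fun θ _ => ?_)
      ((hboundc.mul continuous_const).intervalIntegrable _ _)
    have h := norm_resolvent_quadratic_form_error_le hk hA hTH
      (hTsymm.map _)
      (fun i j hij => by simp [hTtri i j (Or.inr hij)]) hQ hbs hq hQq hAQ
      (fun i => hcirc _ θ (hspecA i).ne) (fun i => hcirc _ θ (hspecT i).ne)
      (fun i => Complex.ofReal_injective.ne (hwT i))
      (fun i => hle 0 F (hFc 0) θ _ (hSA i))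
    have hprod : ∏ i, G θ (hTH.eigenvalues i) ≤ ∏ i : Fin k, sSup (G θ '' S i.succ) :=
      Finset.prod_le_prod (fun i _ => sq_nonneg _)
        fun i _ => hle i.succ G (hGc i.succ) θ _ (hST i)
    have hF0 : 0 ≤ sSup (F θ '' S 0) :=
      Real.sSup_nonneg (by rintro _ ⟨x, -, rfl⟩; exact norm_nonneg _)
    beta_reduce
    rw [norm_smul, ← mul_sub, norm_mul, deriv_circleMap, norm_mul, norm_circleMap_zero,
      Complex.norm_I, mul_one, abs_of_pos hR]
    calc _ ≤ R * (‖f (circleMap c R θ)‖ *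
          ((∏ i : Fin k, sSup (G θ '' S i.succ)) * sSup (F θ '' S 0) * r ^ 2)) := by
          gcongr
          exact h.trans (by gcongr)
      _ = bound θ * r ^ 2 := by rw [hbound]; ring
  rw [hcauchy, intervalIntegral.integral_mul_const] at hnorm
  have hform : star b ⬝ᵥ (Q * matFun hTH (fun x : ℝ => f (x : ℂ)) * Qᴴ).mulVec b =
      star (Qᴴ.mulVec b) ⬝ᵥ (matFun hTH fun x : ℝ => f (x : ℂ)).mulVec (Qᴴ.mulVec b) := by
    rw [star_mulVec, conjTranspose_conjTranspose, ← dotProduct_mulVec, mulVec_mulVec,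
      mulVec_mulVec]
  change _ ≤ (2 * Real.pi)⁻¹ * (∫ θ in (0 : ℝ)..(2 * Real.pi), bound θ) * r ^ 2
  rw [hform, mul_assoc, ← div_eq_inv_mul, le_div_iff₀ (by positivity)]
  refine le_trans (le_of_eq ?_) hnorm
  rw [neg_sub_neg, ← mul_sub, norm_mul, norm_sub_rev, mul_comm]
  simp [abs_of_pos Real.pi_pos]
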